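/- Suppose A_1, …, A_r are stable and A_{r+1}, …, A_k are unstable (1 ≤ r < k). Let ρ_1 = max{‖P_j⁻¹P_i‖ : (i,j) ∈ E(G), i ∈ {1,…,r}}, ρ_2 = max{‖P_j⁻¹P_i‖ : (i,j) ∈ E(G), i ∈ {r+1,…,k}}, λ = min{λ_1, …, λ_r}, μ = max{μ_{r+1}, …, μ_k}. For t ∈ [t_{m−1}, t_m), let N_s(0,t) = #{j ∈ {1,…,m} : σ_j ∈ {1,…,r}} and N_u(0,t) = #{j ∈ {1,…,m} : σ_j ∈ {r+1,…,k}}. Let σ ∈ S_G(τ, η). If N_s(0,t)·(ln ρ_1 − λτ) + N_u(0,t)·(ln ρ_2 + μη) → −∞ as t → ∞, then the switched system is asymptotically stable for σ. -/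

import Mathlib

open Matrix Filter Topology Finset

attribute [local instance] Classical.propDecidable

noncomputable section

/-- The spectral (ℓ² operator) norm of a complex square matrix. -/
def sNorm {n : ℕ} (M : Matrix (Fin n) (Fin n) ℂ) : ℝ :=
  ‖Matrix.toEuclideanCLM (𝕜 := ℂ) M‖

/-- The spectral (ℓ² operator) norm of a real square matrix. -/
def sNormR {n : ℕ} (M : Matrix (Fin n) (Fin n) ℝ) : ℝ :=
  ‖Matrix.toEuclideanCLM (𝕜 := ℝ) M‖

/-- The ordered product `exp(A_{σ_m}(t_m - t_{m-1})) ⋯ exp(A_{σ_1} t_1)` of the switched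
system (0-based: `flow A t v m = exp((t m - t (m-1)) • A (v (m-1))) * ⋯ * exp((t 1 - t 0) • A (v 0))`). -/
def flow {n k : ℕ} (A : Fin k → Matrix (Fin n) (Fin n) ℝ)
    (t : ℕ → ℝ) (v : ℕ → Fin k) : ℕ → Matrix (Fin n) (Fin n) ℝ
  | 0 => 1
  | m + 1 => NormedSpace.exp ((t (m + 1) - t m) • A (v m)) * flow A t v m

/-- Piecewise evaluation: the value `f m` on the interval `[t m, t (m+1))`. -/
def pc {α : Type*} (t : ℕ → ℝ) (f : ℕ → α) (d : α) (s : ℝ) : α :=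
  if h : ∃ m, t m ≤ s ∧ s < t (m + 1) then f h.choose else d

/-- The solution of the switched system `x' = A_{σ(t)} x`, `x(0) = x0`:
for `s ∈ [t m, t (m+1))`, `x(s) = exp((s - t m) • A (v m)) * flow A t v m * x0`. -/
def sol {n k : ℕ} (A : Fin k → Matrix (Fin n) (Fin n) ℝ)
    (t : ℕ → ℝ) (v : ℕ → Fin k) (x0 : EuclideanSpace ℝ (Fin n)) (s : ℝ) :
    EuclideanSpace ℝ (Fin n) :=
  pc t (fun m => Matrix.toEuclideanCLM (𝕜 := ℝ)
    (NormedSpace.exp ((s - t m) • A (v m)) * flow A t v m) x0) 0 s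

/-- A `G`-admissible switching signal: `t 0 = 0`, strictly increasing switching times tending
to infinity, and consecutive vertices joined by edges of `G`.  Here `v m` is the vertex active
on `[t m, t (m+1))` (i.e. `v m = σ_{m+1}` in 1-based notation). -/
def Admissible {k : ℕ} (E : Set (Fin k × Fin k)) (t : ℕ → ℝ) (v : ℕ → Fin k) : Prop :=
  t 0 = 0 ∧ StrictMono t ∧ Tendsto t atTop atTop ∧ ∀ m, (v m, v (m + 1)) ∈ E

/-- A real matrix is stable if all its (complex) eigenvalues have negative real part. -/
def MStable {n : ℕ} (M : Matrix (Fin n) (Fin n) ℝ) : Prop :=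
  ∀ z ∈ spectrum ℂ (M.map (Complex.ofReal)), z.re < 0

/-- A real matrix is unstable if some eigenvalue has positive real part and no eigenvalue has
zero real part. -/
def MUnstable {n : ℕ} (M : Matrix (Fin n) (Fin n) ℝ) : Prop :=
  (∃ z ∈ spectrum ℂ (M.map (Complex.ofReal)), 0 < z.re) ∧
    ∀ z ∈ spectrum ℂ (M.map (Complex.ofReal)), z.re ≠ 0

/-- `a` is the maximum of the real parts of the eigenvalues of `M`. -/
def MaxRe {n : ℕ} (M : Matrix (Fin n) (Fin n) ℝ) (a : ℝ) : Prop :=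
  IsGreatest (Complex.re '' spectrum ℂ (M.map (Complex.ofReal))) a

/-- `M = P D P⁻¹` with `P` invertible and `D` diagonal (diagonalizability over `ℂ`). -/
def Diagonalized {n : ℕ} (M : Matrix (Fin n) (Fin n) ℝ)
    (P D : Matrix (Fin n) (Fin n) ℂ) : Prop :=
  IsUnit P ∧ D.IsDiag ∧ M.map (Complex.ofReal) = P * D * P⁻¹

/-- Asymptotic stability of the switched system for the given signal. -/
def AsympStable {n k : ℕ} (A : Fin k → Matrix (Fin n) (Fin n) ℝ)
    (t : ℕ → ℝ) (v : ℕ → Fin k) : Prop :=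
  ∀ x0 : EuclideanSpace ℝ (Fin n), Tendsto (fun s => ‖sol A t v x0 s‖) atTop (𝓝 0)

/-- Membership in the class `S_G(τ, η)`: dwell time at least `τ` in the stable subsystems
(indices `< r`), flee time at most `η` in the unstable subsystems (indices `≥ r`). -/
def InSG {k : ℕ} (r : ℕ) (τ η : ℝ) (t : ℕ → ℝ) (v : ℕ → Fin k) : Prop :=
  ∀ m, ((v m).1 < r → τ ≤ t (m + 1) - t m) ∧ (r ≤ (v m).1 → t (m + 1) - t m ≤ η)

end

theorem sNorm_mul_le {n : ℕ} (M N : Matrix (Fin n) (Fin n) ℂ) :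
    sNorm (M * N) ≤ sNorm M * sNorm N := by
  unfold sNorm
  rw [map_mul]
  exact norm_mul_le _ _

theorem sNorm_nonneg {n : ℕ} (M : Matrix (Fin n) (Fin n) ℂ) : 0 ≤ sNorm M := norm_nonneg _

theorem map_exp_ofReal {n : ℕ} (M : Matrix (Fin n) (Fin n) ℝ) :
    (NormedSpace.exp M).map Complex.ofReal = NormedSpace.exp (M.map Complex.ofReal) := by
  have hc : Continuous (Complex.ofRealHom.mapMatrix : Matrix (Fin n) (Fin n) ℝ →+* _) := by
    change Continuous (fun M : Matrix (Fin n) (Fin n) ℝ => M.map Complex.ofReal)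
    exact continuous_id.matrix_map Complex.continuous_ofReal
  open scoped Matrix.Norms.Operator in
  exact NormedSpace.map_exp (Complex.ofRealHom.mapMatrix : Matrix (Fin n) (Fin n) ℝ →+* _) hc M

theorem norm_real_le {n : ℕ} (M : Matrix (Fin n) (Fin n) ℝ) (x : EuclideanSpace ℝ (Fin n)) :
    ‖Matrix.toEuclideanCLM (𝕜 := ℝ) M x‖ ≤ sNorm (M.map Complex.ofReal) * ‖x‖ := by
  have key : ∀ y : EuclideanSpace ℝ (Fin n),
      ‖(WithLp.toLp 2 (fun i => (y i : ℂ)) : EuclideanSpace ℂ (Fin n))‖ = ‖y‖ := by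
    intro y
    simp [EuclideanSpace.norm_eq]
  have h := (Matrix.toEuclideanCLM (𝕜 := ℂ) (M.map Complex.ofReal)).le_opNorm
    (WithLp.toLp 2 (fun i => (x i : ℂ)))
  rw [key x] at h
  refine le_trans (le_of_eq ?_) h
  rw [← key]
  congr 1
  ext i
  simp [Matrix.mulVec, dotProduct]

theorem map_exp_eq {n : ℕ} {M : Matrix (Fin n) (Fin n) ℝ} {P D : Matrix (Fin n) (Fin n) ℂ}
    (h : Diagonalized M P D) (d : ℝ) :
    (NormedSpace.exp (d • M)).map Complex.ofReal
      = P * NormedSpace.exp ((d : ℂ) • D) * P⁻¹ := by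
  obtain ⟨hP, hD, hM⟩ := h
  rw [map_exp_ofReal]
  have : (d • M).map Complex.ofReal = P * ((d : ℂ) • D) * P⁻¹ := by
    rw [Matrix.mul_smul, Matrix.smul_mul, ← hM]
    ext i j
    simp
  rw [this, Matrix.exp_conj _ _ hP]

theorem sNorm_exp_le {n : ℕ} {M : Matrix (Fin n) (Fin n) ℝ} {P D : Matrix (Fin n) (Fin n) ℂ}
    (h : Diagonalized M P D) {a : ℝ} (ha : MaxRe M a) {d : ℝ} (hd : 0 ≤ d) :
    sNorm (NormedSpace.exp ((d : ℂ) • D)) ≤ Real.exp (a * d) := by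
  obtain ⟨hP, hD, hM⟩ := h
  have hDd : D = diagonal (diag D) := hD.diagonal_diag.symm
  have hspec : ∀ i, (D i i).re ≤ a := by
    intro i
    apply ha.2
    refine ⟨D i i, ?_, rfl⟩
    rw [hM]
    obtain ⟨u, rfl⟩ := hP
    rw [← Matrix.coe_units_inv, spectrum.units_conjugate, hDd, spectrum_diagonal]
    exact ⟨i, by simp⟩
  rw [hDd, ← Matrix.diagonal_smul, Matrix.exp_diagonal]
  unfold sNorm
  rw [Matrix.l2_opNorm_toEuclideanCLM, Matrix.l2_opNorm_diagonal]
  refine (pi_norm_le_iff_of_nonneg (Real.exp_nonneg _)).2 fun i => ?_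
  rw [Pi.coe_exp, ← Complex.exp_eq_exp_ℂ, Complex.norm_exp]
  apply Real.exp_le_exp.2
  simp only [Pi.smul_apply, diag_apply, smul_eq_mul, Complex.re_ofReal_mul]
  rw [mul_comm]
  exact mul_le_mul_of_nonneg_right (hspec i) hd

theorem pc_eq {α : Type*} {t : ℕ → ℝ} (ht : StrictMono t) (f : ℕ → α) (d : α) {s : ℝ} {m : ℕ}
    (h1 : t m ≤ s) (h2 : s < t (m + 1)) : pc t f d s = f m := by
  have h : ∃ m, t m ≤ s ∧ s < t (m + 1) := ⟨m, h1, h2⟩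
  unfold pc
  rw [dif_pos h]
  congr 1
  obtain ⟨h3, h4⟩ := h.choose_spec
  have a1 := ht.lt_iff_lt.1 (h1.trans_lt h4)
  have a2 := ht.lt_iff_lt.1 (h3.trans_lt h2)
  omega

theorem exists_index {t : ℕ → ℝ} (h0 : t 0 = 0) (ht : Tendsto t atTop atTop) {s : ℝ}
    (hs : 0 ≤ s) (N : ℕ) (hN : ∀ j ≤ N, t j ≤ s) : ∃ m, N ≤ m ∧ t m ≤ s ∧ s < t (m + 1) := by
  have hex : ∃ m, s < t m := (ht.eventually_gt_atTop s).exists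
  have h1 := Nat.find_spec hex
  have hpos : N < Nat.find hex := by
    by_contra hc
    exact absurd (hN _ (not_lt.1 hc)) (not_le.2 h1)
  refine ⟨Nat.find hex - 1, by omega, ?_, ?_⟩
  · exact not_lt.1 (Nat.find_min hex (by omega))
  · rwa [Nat.sub_add_cancel (by omega)]

set_option maxHeartbeats 1000000 in
/-- for a signal in `S_G(τ, η)`, if the piecewise-constant quantity
`N_s(0,t)(ln ρ₁ − λτ) + N_u(0,t)(ln ρ₂ + μη)` tends to `−∞` as `t → ∞`, then the switched
system is asymptotically stable for that signal. -/
theorem stability_of_counting_condition {n k : ℕ} (E : Set (Fin k × Fin k))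
    (r : ℕ) (hr : 1 ≤ r) (hrk : r < k)
    (A : Fin k → Matrix (Fin n) (Fin n) ℝ) (P D : Fin k → Matrix (Fin n) (Fin n) ℂ)
    (hdiag : ∀ i, Diagonalized (A i) (P i) (D i))
    (hstab : ∀ i : Fin k, i.1 < r → MStable (A i))
    (hunst : ∀ i : Fin k, r ≤ i.1 → MUnstable (A i))
    (lam mu : Fin k → ℝ)
    (hlam : ∀ i : Fin k, i.1 < r → MaxRe (A i) (-(lam i)))
    (hmu : ∀ i : Fin k, r ≤ i.1 → MaxRe (A i) (mu i))
    (ρ₁ ρ₂ lmin mumax : ℝ)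
    (hρ₁ : IsGreatest
      {x : ℝ | ∃ i j : Fin k, (i, j) ∈ E ∧ i.1 < r ∧ x = sNorm ((P j)⁻¹ * P i)} ρ₁)
    (hρ₂ : IsGreatest
      {x : ℝ | ∃ i j : Fin k, (i, j) ∈ E ∧ r ≤ i.1 ∧ x = sNorm ((P j)⁻¹ * P i)} ρ₂)
    (hlmin : IsLeast {x : ℝ | ∃ i : Fin k, i.1 < r ∧ x = lam i} lmin)
    (hmumax : IsGreatest {x : ℝ | ∃ i : Fin k, r ≤ i.1 ∧ x = mu i} mumax)
    (τ η : ℝ) (hτ : 0 < τ) (hη : 0 < η)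
    (t : ℕ → ℝ) (v : ℕ → Fin k) (hadm : Admissible E t v) (hsg : InSG r τ η t v)
    (hdiv : Tendsto (fun s : ℝ => pc t (fun m =>
        (((Finset.range (m + 1)).filter (fun j => (v j).1 < r)).card : ℝ) *
          (Real.log ρ₁ - lmin * τ) +
        (((Finset.range (m + 1)).filter (fun j => r ≤ (v j).1)).card : ℝ) *
          (Real.log ρ₂ + mumax * η)) 0 s) atTop atBot) :
    AsympStable A t v := by
  obtain ⟨ht0, htm, htt, hE⟩ := hadm
  -- the counting function
  set F : ℕ → ℝ := fun m =>
    (((Finset.range m).filter (fun j => (v j).1 < r)).card : ℝ) * (Real.log ρ₁ - lmin * τ) +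
      (((Finset.range m).filter (fun j => r ≤ (v j).1)).card : ℝ) * (Real.log ρ₂ + mumax * η)
    with hF
  have hF1 : Tendsto (fun m => F (m + 1)) atTop atBot := by
    have h := hdiv.comp htt
    refine h.congr fun m => ?_
    simp only [Function.comp]
    rw [pc_eq htm _ _ le_rfl (htm (Nat.lt_succ_self m))]
  have hFt : Tendsto F atTop atBot := (tendsto_add_atTop_iff_nat 1).1 hF1
  have hlpos : 0 < lmin := by
    obtain ⟨i, hi, rfl⟩ := hlmin.1
    obtain ⟨z, hz, hzr⟩ := (hlam i hi).1
    have := hstab i hi z hz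
    linarith
  have hmupos : 0 < mumax := by
    obtain ⟨i, hi, rfl⟩ := hmumax.1
    obtain ⟨z, hz, hzr⟩ := (hunst i hi).1
    exact lt_of_lt_of_le hzr ((hmu i hi).2 ⟨z, hz, rfl⟩)
  -- norm bounds for the diagonal exponentials
  have hS : ∀ i : Fin k, i.1 < r → ∀ d a : ℝ, 0 ≤ a → a ≤ d →
      sNorm (NormedSpace.exp ((d : ℂ) • D i)) ≤ Real.exp (-lmin * a) := by
    intro i hi d a ha had
    refine (sNorm_exp_le (hdiag i) (hlam i hi) (ha.trans had)).trans (Real.exp_le_exp.2 ?_)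
    have h1 : lmin ≤ lam i := hlmin.2 ⟨i, hi, rfl⟩
    nlinarith
  have hU : ∀ i : Fin k, r ≤ i.1 → ∀ d : ℝ, 0 ≤ d → d ≤ η →
      sNorm (NormedSpace.exp ((d : ℂ) • D i)) ≤ Real.exp (mumax * η) := by
    intro i hi d hd hdη
    refine (sNorm_exp_le (hdiag i) (hmu i hi) hd).trans (Real.exp_le_exp.2 ?_)
    have h1 : mu i ≤ mumax := hmumax.2 ⟨i, hi, rfl⟩
    nlinarith
  set y : ℕ → Matrix (Fin n) (Fin n) ℂ :=
    fun m => (P (v m))⁻¹ * (flow A t v m).map Complex.ofReal with hy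
  have hmapmul : ∀ M N : Matrix (Fin n) (Fin n) ℝ,
      (M * N).map Complex.ofReal = M.map Complex.ofReal * N.map Complex.ofReal :=
    fun M N => Matrix.map_mul (f := Complex.ofRealHom)
  set C0 := sNorm (y 0) with hC0
  have hC0n : 0 ≤ C0 := sNorm_nonneg _
  have hyb : ∀ m, sNorm (y m) ≤ Real.exp (F m) * C0 := by
    intro m
    induction m with
    | zero => simp [hF, hC0]
    | succ m ih =>
      have hrec : y (m + 1) = ((P (v (m + 1)))⁻¹ * P (v m)) *
          NormedSpace.exp (((t (m + 1) - t m : ℝ) : ℂ) • D (v m)) * y m := by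
        simp only [hy, flow]
        rw [hmapmul, map_exp_eq (hdiag (v m))]
        simp only [Matrix.mul_assoc]
      have hstep : sNorm ((P (v (m + 1)))⁻¹ * P (v m)) *
          sNorm (NormedSpace.exp (((t (m + 1) - t m : ℝ) : ℂ) • D (v m)))
            ≤ Real.exp (F (m + 1) - F m) := by
        have hd : 0 ≤ t (m + 1) - t m := sub_nonneg.2 (htm (Nat.lt_succ_self m)).le
        by_cases hv : (v m).1 < r
        · have hv' : ¬ r ≤ (v m).1 := not_le.2 hv
          have hFF : F (m + 1) - F m = Real.log ρ₁ + -lmin * τ := by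
            simp only [hF, Finset.range_add_one, Finset.filter_insert, hv, hv', if_true, if_false]
            rw [Finset.card_insert_of_notMem (by simp)]
            push_cast
            ring
          rw [hFF, Real.exp_add]
          refine mul_le_mul ((hρ₁.2 ⟨v m, v (m + 1), hE m, hv, rfl⟩).trans (Real.le_exp_log _))
            (hS _ hv _ _ hτ.le ((hsg m).1 hv)) (sNorm_nonneg _) (Real.exp_nonneg _)
        · have hv' : r ≤ (v m).1 := not_lt.1 hv
          have hFF : F (m + 1) - F m = Real.log ρ₂ + mumax * η := by
            simp only [hF, Finset.range_add_one, Finset.filter_insert, hv, hv', if_true, if_false]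
            rw [Finset.card_insert_of_notMem (by simp)]
            push_cast
            ring
          rw [hFF, Real.exp_add]
          refine mul_le_mul ((hρ₂.2 ⟨v m, v (m + 1), hE m, hv', rfl⟩).trans (Real.le_exp_log _))
            (hU _ hv' _ hd ((hsg m).2 hv')) (sNorm_nonneg _) (Real.exp_nonneg _)
      rw [hrec]
      calc _ ≤ _ := sNorm_mul_le _ _
        _ ≤ Real.exp (F (m + 1) - F m) * (Real.exp (F m) * C0) :=
          mul_le_mul ((sNorm_mul_le _ _).trans hstep) ih (sNorm_nonneg _) (Real.exp_nonneg _)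
        _ = Real.exp (F (m + 1)) * C0 := by
          rw [← mul_assoc, ← Real.exp_add]
          congr 2
          ring
  set C1 := ∑ i, sNorm (P i) with hC1
  have hPC : ∀ i, sNorm (P i) ≤ C1 := fun i =>
    Finset.single_le_sum (f := fun i => sNorm (P i)) (fun j _ => sNorm_nonneg _) (Finset.mem_univ i)
  have hC1n : 0 ≤ C1 := Finset.sum_nonneg fun j _ => sNorm_nonneg _
  have hmain : ∀ x0 m s, t m ≤ s → s < t (m + 1) →
      ‖sol A t v x0 s‖ ≤ C1 * Real.exp (mumax * η) * (Real.exp (F m) * C0) * ‖x0‖ := by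
    intro x0 m s h1 h2
    unfold sol
    rw [pc_eq htm _ _ h1 h2]
    refine (norm_real_le _ _).trans (mul_le_mul_of_nonneg_right ?_ (norm_nonneg _))
    have heq : (NormedSpace.exp ((s - t m) • A (v m)) * flow A t v m).map Complex.ofReal
        = P (v m) * NormedSpace.exp (((s - t m : ℝ) : ℂ) • D (v m)) * y m := by
      rw [hmapmul, map_exp_eq (hdiag (v m))]
      simp only [hy, Matrix.mul_assoc]
    rw [heq]
    have hexp : sNorm (NormedSpace.exp (((s - t m : ℝ) : ℂ) • D (v m)))
        ≤ Real.exp (mumax * η) := by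
      by_cases hv : (v m).1 < r
      · refine (hS _ hv _ 0 le_rfl (sub_nonneg.2 h1)).trans (Real.exp_le_exp.2 ?_)
        have := mul_pos hmupos hη
        linarith
      · have hv' : r ≤ (v m).1 := not_lt.1 hv
        exact hU _ hv' _ (sub_nonneg.2 h1) (by linarith [(hsg m).2 hv'])
    refine (sNorm_mul_le _ _).trans (mul_le_mul ?_ (hyb m) (sNorm_nonneg _) (mul_nonneg hC1n (Real.exp_nonneg _)))
    exact (sNorm_mul_le _ _).trans (mul_le_mul (hPC _) hexp (sNorm_nonneg _) hC1n)
  intro x0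
  have hlim : Tendsto (fun m => C1 * Real.exp (mumax * η) * (Real.exp (F m) * C0) * ‖x0‖)
      atTop (𝓝 0) := by
    have h := (Real.tendsto_exp_atBot.comp hFt)
    have h2 := (((h.mul_const C0).const_mul (C1 * Real.exp (mumax * η))).mul_const ‖x0‖)
    simpa using h2
  rw [Metric.tendsto_atTop]
  intro ε hε
  obtain ⟨N, hN⟩ := Filter.eventually_atTop.1 (hlim.eventually (gt_mem_nhds hε))
  refine ⟨t N, fun s hs => ?_⟩
  have hs0 : 0 ≤ s := by
    rw [← ht0]
    exact (htm.monotone (Nat.zero_le N)).trans hs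
  obtain ⟨m, hNm, h1, h2⟩ := exists_index ht0 htt hs0 N
    (fun j hj => (htm.monotone hj).trans hs)
  rw [dist_zero_right, norm_norm]
  exact (hmain x0 m s h1 h2).trans_lt (hN m hNm)
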